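/- Let q = p^l with p an odd prime, and let C be a linear [n,k]_q code with parity check matrix H (an (n−k)×n matrix over F_q with linearly independent rows), where C = {x ∈ F_q^n : H·xᵀ = 0}. Let Ĥ be the matrix whose columns are all nonzero scalar multiples of columns of H, let h : F_q^{n−k} → ℂ be the indicator function of the set of columns of Ĥ, and let ĥ be the Trace transform of h. Then the covering radius ρ(C) equals the smallest natural number j such that the Trace transform of ĥ^j (the pointwise j-th power of ĥ) is nonzero at every y ∈ F_q^{n−k} with y ≠ 0. -/

import Mathlib

open Classical

/-- The Trace transform of a function `h : F^s → ℂ`, where `F` is a finite field of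
characteristic `p` and `ζ ∈ ℂ` (intended: a primitive `p`-th root of unity):
`ĥ(ω) = Σ_x h(x) ζ^{Tr(ω·x)}`, the exponent being the integer representative of the
trace of the dot product. -/
noncomputable def traceTransform (p : ℕ) (F : Type*) [Field F] [Fintype F]
    [Algebra (ZMod p) F] (s : ℕ) (ζ : ℂ) (h : (Fin s → F) → ℂ) : (Fin s → F) → ℂ :=
  fun ω => ∑ x : Fin s → F, h x * ζ ^ (Algebra.trace (ZMod p) F (∑ i, ω i * x i)).val

/-- The covering radius of a code `C` (a set of words of length `n` over `F`): the smallest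
`s` such that every word is within Hamming distance `s` of some codeword. -/
noncomputable def coveringRadius {n : ℕ} {F : Type*} [DecidableEq F]
    (C : Set (Fin n → F)) : ℕ :=
  sInf {s : ℕ | ∀ v : Fin n → F, ∃ c ∈ C, hammingDist v c ≤ s}

/-- The characteristic (indicator) function of the columns of
`Ĥ = (H | α₂H | … | α_{q-1}H)`, i.e. of the set of all nonzero scalar multiples of columns
of the parity check matrix `H`. -/
noncomputable def colIndicator {r n : ℕ} {F : Type*} [CommRing F]
    (H : Matrix (Fin r) (Fin n) F) : (Fin r → F) → ℂ :=
  fun y => if ∃ u : F, u ≠ 0 ∧ ∃ j : Fin n, y = u • (fun i => H i j) then 1 else 0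

/-- The columns of `Ĥ`: the nonzero scalar multiples of the columns of `H`. -/
def scaledColumns {r n : ℕ} {F : Type*} [CommRing F] (H : Matrix (Fin r) (Fin n) F) :
    Set (Fin r → F) :=
  {y | ∃ u : F, u ≠ 0 ∧ ∃ j : Fin n, y = u • (fun i => H i j)}

/-- `y` is a sum of exactly `j` elements of `D`, repetitions allowed. -/
def IsSumOf {V : Type*} [AddCommMonoid V] (D : Set V) (j : ℕ) (y : V) : Prop :=
  ∃ f : Fin j → V, (∀ i, f i ∈ D) ∧ ∑ i, f i = y

section Character

variable {p : ℕ} [Fact p.Prime] {F : Type*} [Field F] [Algebra (ZMod p) F] {ζ : ℂ}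

/-- The additive character `x ↦ ζ ^ Tr x` of `F`. -/
noncomputable def traceChar (F : Type*) [Field F] [Algebra (ZMod p) F]
    (hζ : IsPrimitiveRoot ζ p) : AddChar F ℂ :=
  (AddChar.zmodChar p hζ.pow_eq_one).compAddMonoidHom
    (Algebra.trace (ZMod p) F).toAddMonoidHom

lemma traceChar_apply (hζ : IsPrimitiveRoot ζ p) (x : F) :
    traceChar F hζ x = ζ ^ (Algebra.trace (ZMod p) F x).val := rfl

variable [Fintype F]

lemma traceChar_ne_one (hζ : IsPrimitiveRoot ζ p) : ∃ x, traceChar F hζ x ≠ 1 := by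
  obtain ⟨x, hx⟩ := Algebra.trace_surjective (ZMod p) F 1
  refine ⟨x, ?_⟩
  have hp : 1 < p := (Fact.out : p.Prime).one_lt
  have : Fact (1 < p) := ⟨hp⟩
  rw [traceChar_apply, hx, ZMod.val_one, pow_one]
  exact hζ.ne_one hp

lemma sum_traceChar_dotProduct (hζ : IsPrimitiveRoot ζ p) {s : ℕ} (z : Fin s → F) :
    ∑ ω : Fin s → F, traceChar F hζ (ω ⬝ᵥ z) =
      if z = 0 then (Fintype.card (Fin s → F) : ℂ) else 0 := by
  split_ifs with hz
  · simp [hz]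
  obtain ⟨i, hi⟩ := Function.ne_iff.mp hz
  obtain ⟨x, hx⟩ := traceChar_ne_one (F := F) hζ
  let χ : AddChar (Fin s → F) ℂ := (traceChar F hζ).compAddMonoidHom
    { toFun := fun ω => ω ⬝ᵥ z
      map_zero' := zero_dotProduct z
      map_add' := fun a b => add_dotProduct a b z }
  have hχ : χ ≠ 0 := by
    rw [AddChar.ne_zero_iff]
    refine ⟨Pi.single i (x / z i), ?_⟩
    change traceChar F hζ (Pi.single i (x / z i) ⬝ᵥ z) ≠ 1
    rwa [single_dotProduct, div_mul_cancel₀ _ hi]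
  exact AddChar.sum_eq_zero_iff_ne_zero.mpr hχ

lemma traceTransform_apply (hζ : IsPrimitiveRoot ζ p) {s : ℕ} (h : (Fin s → F) → ℂ)
    (ω : Fin s → F) :
    traceTransform p F s ζ h ω = ∑ x, h x * traceChar F hζ (ω ⬝ᵥ x) := rfl

lemma traceTransform_pow_apply (hζ : IsPrimitiveRoot ζ p) {s : ℕ} (h : (Fin s → F) → ℂ)
    (j : ℕ) (ω : Fin s → F) :
    (traceTransform p F s ζ h ^ j) ω =
      ∑ f : Fin j → Fin s → F, (∏ i, h (f i)) * traceChar F hζ (ω ⬝ᵥ ∑ i, f i) := by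
  rw [Pi.pow_apply, traceTransform_apply hζ, Fintype.sum_pow]
  refine Finset.sum_congr rfl fun f _ => ?_
  rw [Finset.prod_mul_distrib, dotProduct_sum]
  exact congrArg _ (map_prod (traceChar F hζ).toMonoidHom
    (fun i => Multiplicative.ofAdd (ω ⬝ᵥ f i)) Finset.univ).symm

lemma traceTransform_traceTransform_pow (hζ : IsPrimitiveRoot ζ p) {s : ℕ}
    (h : (Fin s → F) → ℂ) (j : ℕ) (y : Fin s → F) :
    traceTransform p F s ζ (traceTransform p F s ζ h ^ j) y =
      Fintype.card (Fin s → F) *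
        ∑ f : Fin j → Fin s → F, if ∑ i, f i = -y then ∏ i, h (f i) else 0 := by
  simp_rw [traceTransform_apply hζ (traceTransform p F s ζ h ^ j),
    traceTransform_pow_apply hζ, Finset.sum_mul]
  rw [Finset.sum_comm, Finset.mul_sum]
  refine Finset.sum_congr rfl fun f _ => ?_
  have key (ω : Fin s → F) :
      (∏ i, h (f i)) * traceChar F hζ (ω ⬝ᵥ ∑ i, f i) * traceChar F hζ (y ⬝ᵥ ω) =
        (∏ i, h (f i)) * traceChar F hζ (ω ⬝ᵥ (∑ i, f i + y)) := by
    rw [dotProduct_add, AddChar.map_add_eq_mul, dotProduct_comm y ω, mul_assoc]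
  simp_rw [key, ← Finset.mul_sum, sum_traceChar_dotProduct hζ, add_eq_zero_iff_eq_neg]
  split_ifs <;> ring

lemma traceTransform_colIndicator_pow_ne_zero_iff (hζ : IsPrimitiveRoot ζ p) {r n : ℕ}
    (H : Matrix (Fin r) (Fin n) F) (j : ℕ) (y : Fin r → F) :
    traceTransform p F r ζ (traceTransform p F r ζ (colIndicator H) ^ j) y ≠ 0 ↔
      IsSumOf (scaledColumns H) j (-y) := by
  have hprod (f : Fin j → Fin r → F) : ∏ i, colIndicator H (f i) =
      if ∀ i, f i ∈ scaledColumns H then (1 : ℂ) else 0 := by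
    have := Finset.prod_ite_zero (s := (Finset.univ : Finset (Fin j)))
      (p := fun i => f i ∈ scaledColumns H) (f := fun _ => (1 : ℂ))
    simpa only [Finset.prod_const_one, Finset.mem_univ, forall_const] using! this
  rw [traceTransform_traceTransform_pow hζ]
  simp_rw [hprod, ← ite_and, Finset.sum_boole]
  rw [mul_ne_zero_iff, Nat.cast_ne_zero, Nat.cast_ne_zero, Finset.card_ne_zero]
  simp only [ne_eq, Fintype.card_ne_zero, not_false_eq_true, true_and, Finset.Nonempty,
    Finset.mem_filter, Finset.mem_univ, IsSumOf]
  exact exists_congr fun f => and_comm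

end Character

section Sums

variable {F : Type*} [Field F] {r n : ℕ} {H : Matrix (Fin r) (Fin n) F}

lemma mulVec_eq_sum_smul_col (H : Matrix (Fin r) (Fin n) F) (e : Fin n → F) :
    H.mulVec e = ∑ t, e t • (fun i => H i t) := by
  ext i
  simp [Matrix.mulVec, dotProduct, Finset.sum_apply, mul_comm]

lemma IsSumOf.exists_mulVec_eq [DecidableEq F] {j : ℕ} {y : Fin r → F}
    (h : IsSumOf (scaledColumns H) j y) :
    ∃ e : Fin n → F, H.mulVec e = y ∧ hammingNorm e ≤ j := by
  obtain ⟨f, hf, rfl⟩ := h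
  choose u _ t ht using hf
  refine ⟨∑ i, Pi.single (t i) (u i), ?_, ?_⟩
  · rw [Matrix.mulVec_sum]
    refine Finset.sum_congr rfl fun i _ => ?_
    rw [ht i]
    ext a
    simp [mul_comm]
  · have hsub : ({a | (∑ i, Pi.single (t i) (u i) : Fin n → F) a ≠ 0} : Finset (Fin n)) ⊆
        Finset.univ.image t := by
      intro a ha
      by_contra hna
      refine (Finset.mem_filter.mp ha).2 ?_
      rw [Finset.sum_apply]
      refine Finset.sum_eq_zero fun i _ => Pi.single_eq_of_ne ?_ _
      rintro rfl
      exact hna (Finset.mem_image_of_mem t (Finset.mem_univ i))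
    calc hammingNorm (∑ i, Pi.single (t i) (u i) : Fin n → F)
        ≤ (Finset.univ.image t).card := by
          unfold hammingNorm
          convert Finset.card_le_card hsub
      _ ≤ j := Finset.card_image_le.trans (by simp)

lemma isSumOf_mulVec [DecidableEq F] (H : Matrix (Fin r) (Fin n) F) (e : Fin n → F) :
    IsSumOf (scaledColumns H) (hammingNorm e) (H.mulVec e) := by
  let S : Finset (Fin n) := {t | e t ≠ 0}
  let φ : S ≃ Fin (hammingNorm e) := S.equivFinOfCardEq rfl
  refine ⟨fun i => e (φ.symm i) • (fun a => H a (φ.symm i)), fun i => ?_, ?_⟩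
  · exact ⟨_, (Finset.mem_filter.mp (φ.symm i).2).2, _, rfl⟩
  · rw [φ.symm.sum_comp (fun t : S => e t • (fun a => H a t)),
      Finset.sum_coe_sort S (fun t => e t • (fun a => H a t)), mulVec_eq_sum_smul_col]
    refine Finset.sum_subset (Finset.subset_univ S) fun t _ ht => ?_
    have : e t = 0 := by simpa [S] using ht
    rw [this, zero_smul]

lemma IsSumOf.succ [Fintype F] (hF : 2 < Fintype.card F) {j : ℕ} {y : Fin r → F}
    (h : IsSumOf (scaledColumns H) (j + 1) y) : IsSumOf (scaledColumns H) (j + 2) y := by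
  obtain ⟨f, hf, rfl⟩ := h
  obtain ⟨v, hv0, hv1⟩ := ENat.exists_ne_ne_of_three_le
    (by rw [ENat.card_eq_coe_fintype_card]; exact_mod_cast hF) (0 : F) 1
  have smul_mem {c : F} (hc : c ≠ 0) : c • f 0 ∈ scaledColumns H := by
    obtain ⟨u, hu, t, ht⟩ := hf 0
    exact ⟨c * u, mul_ne_zero hc hu, t, by rw [ht, smul_smul]⟩
  refine ⟨Fin.cons (v • f 0) (Fin.cons ((1 - v) • f 0) (Fin.tail f)), ?_, ?_⟩
  · refine Fin.cases ?_ (Fin.cases ?_ fun i => ?_)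
    · simpa using smul_mem hv0
    · simpa using smul_mem (sub_ne_zero.mpr (Ne.symm hv1))
    · simpa [Fin.tail] using hf i.succ
  · rw [Fin.sum_univ_succ, Fin.sum_univ_succ, Fin.sum_univ_succ f]
    simp only [Fin.cons_zero, Fin.cons_succ, Fin.tail]
    rw [← add_assoc, ← add_smul]
    simp

lemma IsSumOf.mono [Fintype F] (hF : 2 < Fintype.card F) {w j : ℕ} (hw : w ≠ 0) (hwj : w ≤ j)
    {y : Fin r → F} (h : IsSumOf (scaledColumns H) w y) : IsSumOf (scaledColumns H) j y := by
  induction j, hwj using Nat.le_induction with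
  | base => exact h
  | succ m hm ih =>
    obtain ⟨m, rfl⟩ := Nat.exists_eq_succ_of_ne_zero (by omega : m ≠ 0)
    exact ih.succ hF

lemma isSumOf_iff_exists_mulVec_eq [Fintype F] [DecidableEq F] (hF : 2 < Fintype.card F) {j : ℕ}
    {y : Fin r → F} (hy : y ≠ 0) :
    IsSumOf (scaledColumns H) j y ↔ ∃ e : Fin n → F, H.mulVec e = y ∧ hammingNorm e ≤ j := by
  refine ⟨IsSumOf.exists_mulVec_eq, ?_⟩
  rintro ⟨e, rfl, he⟩
  refine (isSumOf_mulVec H e).mono hF ?_ he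
  rw [hammingNorm_ne_zero_iff]
  rintro rfl
  exact hy H.mulVec_zero

lemma exists_hammingDist_le_iff [DecidableEq F] (H : Matrix (Fin r) (Fin n) F) (v : Fin n → F)
    (s : ℕ) :
    (∃ c ∈ {x : Fin n → F | H.mulVec x = 0}, hammingDist v c ≤ s) ↔
      ∃ e : Fin n → F, H.mulVec e = H.mulVec v ∧ hammingNorm e ≤ s := by
  constructor
  · rintro ⟨c, hc, h⟩
    refine ⟨-c + v, ?_, ?_⟩
    · rw [Matrix.mulVec_add, Matrix.mulVec_neg, hc, neg_zero, zero_add]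
    · rwa [← hammingDist_eq_hammingNorm, hammingDist_comm]
  · rintro ⟨e, he, h⟩
    refine ⟨v - e, by simp [Matrix.mulVec_sub, he], ?_⟩
    rwa [hammingDist_comm, hammingDist_eq_hammingNorm, neg_sub, sub_add_cancel]

lemma mulVec_surjective_of_linearIndependent_rows (hH : LinearIndependent F (fun i => H i)) :
    Function.Surjective H.mulVec := by
  have hrank : H.rank = r := by simpa using LinearIndependent.rank_matrix hH
  have hrange : LinearMap.range H.mulVecLin = ⊤ :=
    Submodule.eq_top_of_finrank_eq (hrank.trans (Module.finrank_fin_fun F).symm)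
  exact LinearMap.range_eq_top.mp hrange

lemma forall_exists_hammingDist_le_iff [Fintype F] [DecidableEq F] (hF : 2 < Fintype.card F)
    (hH : LinearIndependent F (fun i => H i)) (s : ℕ) :
    (∀ v : Fin n → F, ∃ c ∈ {x : Fin n → F | H.mulVec x = 0}, hammingDist v c ≤ s) ↔
      ∀ y : Fin r → F, y ≠ 0 → IsSumOf (scaledColumns H) s (-y) := by
  simp_rw [exists_hammingDist_le_iff]
  constructor
  · intro h y hy
    obtain ⟨v, hv⟩ := mulVec_surjective_of_linearIndependent_rows hH (-y)
    rw [isSumOf_iff_exists_mulVec_eq hF (neg_ne_zero.mpr hy), ← hv]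
    exact h v
  · intro h v
    by_cases hv : H.mulVec v = 0
    · exact ⟨0, by simp [hv], by simp⟩
    · have := h (-H.mulVec v) (neg_ne_zero.mpr hv)
      rw [neg_neg] at this
      exact this.exists_mulVec_eq

end Sums

/-- for `q = p^l` with `p` an odd prime and a linear `[n,k]_q` code `C` with
parity check matrix `H`, the covering radius of `C` is the least natural number `j` such
that the Trace transform of `ĥ^j` is nonzero at every nonzero `y ∈ F^{n-k}`, where `ĥ` is
the Trace transform of the indicator function of the columns of `Ĥ`. -/
theorem coveringRadius_eq_least_traceTransform_pow_ne_zero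
    (p l : ℕ) [Fact p.Prime] (hodd : Odd p) (hl : 1 ≤ l)
    (F : Type*) [Field F] [Fintype F] [DecidableEq F] [Algebra (ZMod p) F]
    (hF : Fintype.card F = p ^ l)
    (ζ : ℂ) (hζ : IsPrimitiveRoot ζ p)
    (n k : ℕ) (hkn : k ≤ n)
    (H : Matrix (Fin (n - k)) (Fin n) F)
    (hH : LinearIndependent F (fun i => H i)) :
    IsLeast {j : ℕ | ∀ y : Fin (n - k) → F, y ≠ 0 →
        traceTransform p F (n - k) ζ
          ((traceTransform p F (n - k) ζ (colIndicator H)) ^ j) y ≠ 0}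
      (coveringRadius {x : Fin n → F | H.mulVec x = 0}) := by
  have hcard : 2 < Fintype.card F := by
    have h2 : 2 < p := lt_of_le_of_ne (Fact.out : p.Prime).two_le
      (by rintro rfl; exact absurd hodd (by decide))
    rw [hF]
    exact h2.trans_le (Nat.le_self_pow (by omega) p)
  simp_rw [traceTransform_colIndicator_pow_ne_zero_iff hζ,
    ← forall_exists_hammingDist_le_iff hcard hH]
  refine ⟨Nat.sInf_mem ⟨n, fun v => ⟨0, H.mulVec_zero, ?_⟩⟩, fun s hs => Nat.sInf_le hs⟩
  simpa using hammingDist_le_card_fintype (x := v) (y := 0)
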